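/- Let ρ be a d×d density matrix, D a Lindblad dissipator built from matrices L_1,…,L_m, and γ > 0. Then there exists a Hermitian d×d matrix H with −i(Hρ − ρH) + γ D(ρ) = 0 if and only if Tr(D(ρ) X) = 0 for every d×d complex matrix X satisfying Xρ = ρX. -/

import Mathlib

open Matrix
open scoped ComplexOrder

namespace Matrix

variable {n : Type*} [Fintype n] [DecidableEq n]

/-- A Hermitian matrix whose entries vanish on the level sets of `l` is `i` times the commutator of
a Hermitian matrix with `diagonal l`. -/
theorem IsHermitian.exists_commutator_diagonal_eq {B : Matrix n n ℂ} (hB : B.IsHermitian)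
    (l : n → ℝ) (h : ∀ i j, l i = l j → B i j = 0) :
    ∃ K : Matrix n n ℂ, K.IsHermitian ∧
      Complex.I • (K * diagonal (fun i => (l i : ℂ)) - diagonal (fun i => (l i : ℂ)) * K) = B := by
  refine ⟨of fun i j => -Complex.I * B i j / ((l j : ℂ) - l i), ?_, ?_⟩
  · ext i j
    have hij : star (B j i) = B i j := hB.apply i j
    simp only [conjTranspose_apply, of_apply, star_div₀, star_mul', hij, star_neg, star_sub,
      Complex.star_def, Complex.conj_I, Complex.conj_ofReal, neg_neg]
    rw [← neg_sub (l j : ℂ) (l i), div_neg, neg_mul, neg_div]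
  · ext i j
    simp only [smul_apply, sub_apply, mul_diagonal, diagonal_mul, of_apply, smul_eq_mul]
    by_cases hij : l i = l j
    · simp [h i j hij]
    · have hne : (l j : ℂ) - l i ≠ 0 := sub_ne_zero.2 fun e => hij (by exact_mod_cast e.symm)
      field_simp
      linear_combination -(B i j * (l j - l i)) * Complex.I_sq

/-- If a Hermitian matrix `A` is trace-orthogonal to the commutant of a Hermitian matrix `ρ`, it is
`i` times the commutator of a Hermitian matrix with `ρ`. -/
theorem IsHermitian.exists_commutator_eq {ρ A : Matrix n n ℂ} (hρ : ρ.IsHermitian)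
    (hA : A.IsHermitian) (h : ∀ X : Matrix n n ℂ, X * ρ = ρ * X → (A * X).trace = 0) :
    ∃ H : Matrix n n ℂ, H.IsHermitian ∧ Complex.I • (H * ρ - ρ * H) = A := by
  obtain ⟨U, l, hUU, hUU', hρU⟩ : ∃ (U : Matrix n n ℂ) (l : n → ℝ), Uᴴ * U = 1 ∧ U * Uᴴ = 1 ∧
      ρ = U * diagonal (fun i => (l i : ℂ)) * Uᴴ :=
    ⟨hρ.eigenvectorUnitary, hρ.eigenvalues, Unitary.coe_star_mul_self _,
      Unitary.coe_mul_star_self _, hρ.spectral_theorem⟩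
  have cancel (M : Matrix n n ℂ) : Uᴴ * (U * M) = M := by rw [← mul_assoc, hUU, one_mul]
  have cancel' (M : Matrix n n ℂ) : U * (Uᴴ * M) = M := by rw [← mul_assoc, hUU', one_mul]
  obtain ⟨K, hK, hKB⟩ := (isHermitian_conjTranspose_mul_mul U hA).exists_commutator_diagonal_eq l
    fun i j hij => by
      have hX := h (U * single j i 1 * Uᴴ) (by
        have hc : single j i (1 : ℂ) * diagonal (fun i => (l i : ℂ)) =
            diagonal (fun i => (l i : ℂ)) * single j i 1 := by
          ext a b
          rw [mul_diagonal, diagonal_mul]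
          by_cases hab : j = a ∧ i = b
          · obtain ⟨rfl, rfl⟩ := hab
            simp [hij]
          · simp [hab]
        simp only [hρU, mul_assoc, cancel]
        simp only [← mul_assoc _ _ Uᴴ, hc])
      rw [← mul_assoc, trace_mul_comm, ← mul_assoc, ← mul_assoc, trace_mul_single] at hX
      simpa using hX
  refine ⟨U * K * Uᴴ, isHermitian_mul_mul_conjTranspose U hK, ?_⟩
  have hA' := congrArg (fun M => U * M * Uᴴ) hKB
  simpa only [hρU, mul_smul_comm, smul_mul_assoc, mul_sub, sub_mul, mul_assoc, cancel, cancel',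
    hUU', mul_one] using hA'

end Matrix

theorem stmt_2 {d m : ℕ}
    (ρ : Matrix (Fin d) (Fin d) ℂ)
    (hPSD : ρ.PosSemidef) (hTr : ρ.trace = 1)
    (L : Fin m → Matrix (Fin d) (Fin d) ℂ)
    (D : Matrix (Fin d) (Fin d) ℂ → Matrix (Fin d) (Fin d) ℂ)
    (hD : ∀ M, D M = ∑ j, (L j * M * (L j)ᴴ
      - (1/2 : ℂ) • ((L j)ᴴ * L j * M + M * ((L j)ᴴ * L j))))
    (γ : ℝ) (hγ : 0 < γ) :
    (∃ H : Matrix (Fin d) (Fin d) ℂ, H.IsHermitian ∧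
        (-Complex.I) • (H * ρ - ρ * H) + (γ : ℂ) • D ρ = 0) ↔
    (∀ X : Matrix (Fin d) (Fin d) ℂ, X * ρ = ρ * X → (D ρ * X).trace = 0) := by
  have hγ' : (γ : ℂ) ≠ 0 := by exact_mod_cast hγ.ne'
  constructor
  · rintro ⟨H, -, hH⟩ X hX
    have hcomm : ((H * ρ - ρ * H) * X).trace = 0 := by
      rw [sub_mul, trace_sub, mul_assoc, ← hX, mul_assoc ρ, trace_mul_comm ρ, mul_assoc H, sub_self]
    have hzero := congrArg (fun M => (M * X).trace) hH
    simpa [add_mul, smul_mul_assoc, hcomm, hγ'] using hzero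
  · intro h
    have hρ : ρᴴ = ρ := hPSD.isHermitian
    have hDρ : (D ρ).IsHermitian := by
      rw [hD, IsHermitian, conjTranspose_sum]
      refine Finset.sum_congr rfl fun j _ => ?_
      simp [conjTranspose_sub, conjTranspose_smul, conjTranspose_mul, hρ, mul_assoc, add_comm]
    obtain ⟨H, hH, hHD⟩ := hPSD.isHermitian.exists_commutator_eq (A := γ • D ρ)
      (by rw [IsHermitian, conjTranspose_smul, hDρ.eq, star_trivial])
      fun X hX => by rw [smul_mul_assoc, trace_smul, h X hX, smul_zero]
    exact ⟨H, hH, by rw [neg_smul, hHD, Complex.coe_smul, neg_add_cancel]⟩
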